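/- Spectral gap of the fiber operator on convex cones (Proposition 4.6, on the core): Let ω ∈ (0, π/2) and k ∈ ℤ. Then for every ψ ∈ M one has ‖T_k ψ‖_{L²((0,ω);ℂ⁴)} ≥ (π/(4ω) + 1/2) · ‖ψ‖_{L²((0,ω);ℂ⁴)}; in particular T_kψ = 0 implies ψ = 0. -/

import Mathlib

open MeasureTheory Real Set

noncomputable section

/-- First component of the fiber differential expression `τ_k` applied to a pair `(f,g)`:
`(k+1) f − g' − (k+1/2) cot θ · g`. -/
def tauFst (k : ℤ) (f g : ℝ → ℂ) (θ : ℝ) : ℂ :=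
  ((k : ℂ) + 1) * f θ - deriv g θ
    - ((k : ℂ) + 1 / 2) * ((Real.cos θ / Real.sin θ : ℝ) : ℂ) * g θ

/-- Second component of the fiber differential expression `τ_k` applied to a pair `(f,g)`:
`f' − (k+1/2) cot θ · f − k g`. -/
def tauSnd (k : ℤ) (f g : ℝ → ℂ) (θ : ℝ) : ℂ :=
  deriv f θ - ((k : ℂ) + 1 / 2) * ((Real.cos θ / Real.sin θ : ℝ) : ℂ) * f θ
    - (k : ℂ) * g θ

/-- The core `M` of the fiber operator `T_k`: smooth `ℂ⁴`-valued functions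
`ψ = (ψ₁,ψ₂,ψ₃,ψ₄)` on `(0,ω]` with compact support in `(0,ω]` satisfying the boundary
condition `(ψ₁(ω), ψ₂(ω))ᵀ = A_ω (ψ₃(ω), ψ₄(ω))ᵀ` with
`A_ω = [[i sin ω, −i cos ω], [−i cos ω, −i sin ω]]`. -/
def InCore (ω : ℝ) (ψ₁ ψ₂ ψ₃ ψ₄ : ℝ → ℂ) : Prop :=
  ContDiffOn ℝ (⊤ : ℕ∞) ψ₁ (Ioc 0 ω) ∧ ContDiffOn ℝ (⊤ : ℕ∞) ψ₂ (Ioc 0 ω)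
    ∧ ContDiffOn ℝ (⊤ : ℕ∞) ψ₃ (Ioc 0 ω) ∧ ContDiffOn ℝ (⊤ : ℕ∞) ψ₄ (Ioc 0 ω)
    ∧ IsCompact (tsupport ψ₁) ∧ tsupport ψ₁ ⊆ Ioc 0 ω
    ∧ IsCompact (tsupport ψ₂) ∧ tsupport ψ₂ ⊆ Ioc 0 ω
    ∧ IsCompact (tsupport ψ₃) ∧ tsupport ψ₃ ⊆ Ioc 0 ω
    ∧ IsCompact (tsupport ψ₄) ∧ tsupport ψ₄ ⊆ Ioc 0 ω
    ∧ ψ₁ ω = Complex.I * (Real.sin ω : ℂ) * ψ₃ ω - Complex.I * (Real.cos ω : ℂ) * ψ₄ ω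
    ∧ ψ₂ ω = -Complex.I * (Real.cos ω : ℂ) * ψ₃ ω - Complex.I * (Real.sin ω : ℂ) * ψ₄ ω


lemma pt_ineq (f : ℝ → ℂ) (f' : ℂ) (w : ℝ → ℝ) (w' a μ θ : ℝ)
    (hf : HasDerivAt f f' θ) (hw : HasDerivAt w w' θ)
    (h : w' + 2 * a * w θ + w θ ^ 2 ≤ - μ ^ 2) :
    ∃ d : ℝ, HasDerivAt (fun t => w t * ‖f t‖ ^ 2) d θ ∧
      d ≤ ‖f' - (a : ℂ) * f θ‖ ^ 2 - μ ^ 2 * ‖f θ‖ ^ 2 := by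
  refine ⟨_, hw.mul hf.norm_sq, ?_⟩
  have e : inner ℝ (f θ) f' = (f θ).re * f'.re + (f θ).im * f'.im := by
    simp [Complex.inner]; ring
  rw [e]
  simp only [Complex.sq_norm, Complex.normSq_apply, Complex.sub_re, Complex.sub_im,
    Complex.mul_re, Complex.mul_im, Complex.ofReal_re, Complex.ofReal_im]
  nlinarith [sq_nonneg (f'.re - (a + w θ) * (f θ).re), sq_nonneg (f'.im - (a + w θ) * (f θ).im),
    mul_le_mul_of_nonneg_right h (add_nonneg (sq_nonneg (f θ).re) (sq_nonneg (f θ).im))]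

lemma rot_norm (c s : ℝ) (h : c ^ 2 + s ^ 2 = 1) (x y : ℂ) :
    ‖(c : ℂ) * x + s * y‖ ^ 2 + ‖-(s : ℂ) * x + c * y‖ ^ 2 = ‖x‖ ^ 2 + ‖y‖ ^ 2 := by
  simp only [Complex.sq_norm, Complex.normSq_apply, Complex.add_re, Complex.add_im, Complex.neg_re,
    Complex.neg_im,
    Complex.mul_re, Complex.mul_im, Complex.ofReal_re, Complex.ofReal_im]
  linear_combination (x.re ^ 2 + x.im ^ 2 + y.re ^ 2 + y.im ^ 2) * h

/-- rotated components -/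
def rotA (f g : ℝ → ℂ) (θ : ℝ) : ℂ := (Real.cos (θ / 2) : ℂ) * f θ + (Real.sin (θ / 2) : ℂ) * g θ
def rotB (f g : ℝ → ℂ) (θ : ℝ) : ℂ := -(Real.sin (θ / 2) : ℂ) * f θ + (Real.cos (θ / 2) : ℂ) * g θ

lemma rot_pair (f g : ℝ → ℂ) (θ : ℝ) :
    ‖rotA f g θ‖ ^ 2 + ‖rotB f g θ‖ ^ 2 = ‖f θ‖ ^ 2 + ‖g θ‖ ^ 2 :=
  rot_norm _ _ (Real.cos_sq_add_sin_sq _) _ _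

lemma hasDeriv_cos_half (θ : ℝ) : HasDerivAt (fun t : ℝ => (Real.cos (t / 2) : ℂ))
    ((-Real.sin (θ / 2) / 2 : ℝ) : ℂ) θ := by
  have h : HasDerivAt (fun t : ℝ => Real.cos (t / 2)) (-Real.sin (θ / 2) / 2) θ := by
    refine (((hasDerivAt_id θ).div_const 2).cos).congr_deriv ?_
    change -Real.sin (θ / 2) * (1 / 2) = _
    ring
  exact h.ofReal_comp

lemma hasDeriv_sin_half (θ : ℝ) : HasDerivAt (fun t : ℝ => (Real.sin (t / 2) : ℂ))
    ((Real.cos (θ / 2) / 2 : ℝ) : ℂ) θ := by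
  have h : HasDerivAt (fun t : ℝ => Real.sin (t / 2)) (Real.cos (θ / 2) / 2) θ := by
    refine (((hasDerivAt_id θ).div_const 2).sin).congr_deriv ?_
    change Real.cos (θ / 2) * (1 / 2) = _
    ring
  exact h.ofReal_comp

lemma tau_rot (k : ℤ) (f g : ℝ → ℂ) (θ : ℝ) (hs : Real.sin θ ≠ 0)
    (hf : DifferentiableAt ℝ f θ) (hg : DifferentiableAt ℝ g θ) :
    ∃ A B : ℂ, HasDerivAt (rotA f g) A θ ∧ HasDerivAt (rotB f g) B θ ∧
      ‖A - ((((k : ℝ) + 1 / 2) / Real.sin θ : ℝ) : ℂ) * rotA f g θ‖ ^ 2 +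
      ‖B - ((-(((k : ℝ) + 1 / 2) / Real.sin θ) : ℝ) : ℂ) * rotB f g θ‖ ^ 2 =
      ‖tauFst k f g θ‖ ^ 2 + ‖tauSnd k f g θ‖ ^ 2 := by
  refine ⟨_, _, ((hasDeriv_cos_half θ).mul hf.hasDerivAt).add
    ((hasDeriv_sin_half θ).mul hg.hasDerivAt), ((hasDeriv_sin_half θ).neg.mul hf.hasDerivAt).add
    ((hasDeriv_cos_half θ).mul hg.hasDerivAt), ?_⟩
  rw [← rot_norm _ _ (Real.cos_sq_add_sin_sq (θ / 2)) (tauFst k f g θ), add_comm (‖_‖ ^ 2) (‖_‖ ^ 2)]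
  have e1 : Real.sin θ = 2 * Real.sin (θ / 2) * Real.cos (θ / 2) := by
    rw [← Real.sin_two_mul]; congr 1; ring
  have e2 : Real.cos θ = 2 * Real.cos (θ / 2) ^ 2 - 1 := by
    rw [← Real.cos_two_mul]; congr 1; ring
  have e3 := Real.sin_sq_add_cos_sq (θ / 2)
  rw [e1] at hs
  unfold tauFst tauSnd rotA rotB
  simp only [Pi.neg_apply]
  rw [e1, e2]
  generalize Real.sin (θ / 2) = s at *
  generalize Real.cos (θ / 2) = c at *
  have hs0 : (s : ℂ) ≠ 0 := by
    intro h; apply hs; simp [Complex.ofReal_eq_zero.1 h]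
  have hc0 : (c : ℂ) ≠ 0 := by
    intro h; apply hs; simp [Complex.ofReal_eq_zero.1 h]
  have e4 : (s : ℂ) ^ 2 = 1 - (c : ℂ) ^ 2 := by
    rw [eq_sub_iff_add_eq]; exact_mod_cast e3
  congr 2
  · rw [← norm_neg]
    congr 1
    push_cast
    field_simp
    ring_nf
    simp only [e4]
    ring
  · congr 1
    push_cast
    field_simp
    ring_nf
    simp only [e4]
    ring

lemma vanish_near (f : ℝ → ℂ) (ω : ℝ) (hf : tsupport f ⊆ Ioc 0 ω) :
    ∀ᶠ t in nhds (0 : ℝ), t ∉ tsupport f :=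
  (isClosed_tsupport f).isOpen_compl.mem_nhds (fun h => lt_irrefl _ (hf h).1)

lemma tau_contExt (k : ℤ) (ω ε : ℝ) (hω : ω < π / 2) (hε : 0 < ε) (f g : ℝ → ℂ)
    (hf : ContDiffOn ℝ (⊤ : ℕ∞) f (Ioc 0 ω)) (hg : ContDiffOn ℝ (⊤ : ℕ∞) g (Ioc 0 ω)) :
    IntegrableOn (fun θ => ‖tauFst k f g θ‖ ^ 2 + ‖tauSnd k f g θ‖ ^ 2) (Ioo ε ω) := by
  rcases le_or_gt ω ε with h | h
  · simp [Ioo_eq_empty (not_lt.2 h)]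
  have hsub : Icc ε ω ⊆ Ioc 0 ω := fun x hx => ⟨hε.trans_le hx.1, hx.2⟩
  have cf := (hf.continuousOn_derivWithin (uniqueDiffOn_Ioc 0 ω) (by norm_cast)).mono hsub
  have cg := (hg.continuousOn_derivWithin (uniqueDiffOn_Ioc 0 ω) (by norm_cast)).mono hsub
  have cf0 := hf.continuousOn.mono hsub
  have cg0 := hg.continuousOn.mono hsub
  have hcot : ContinuousOn (fun θ : ℝ => ((Real.cos θ / Real.sin θ : ℝ) : ℂ)) (Icc ε ω) := by
    apply Complex.continuous_ofReal.comp_continuousOn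
    apply Real.continuous_cos.continuousOn.div Real.continuous_sin.continuousOn
    intro x hx
    exact (Real.sin_pos_of_pos_of_lt_pi (hsub hx).1 (by linarith [hx.2, Real.pi_pos])).ne'
  have hc : ContinuousOn (fun θ =>
      ‖((k : ℂ) + 1) * f θ - derivWithin g (Ioc 0 ω) θ
        - ((k : ℂ) + 1 / 2) * ((Real.cos θ / Real.sin θ : ℝ) : ℂ) * g θ‖ ^ 2 +
      ‖derivWithin f (Ioc 0 ω) θ - ((k : ℂ) + 1 / 2) * ((Real.cos θ / Real.sin θ : ℝ) : ℂ) * f θ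
        - (k : ℂ) * g θ‖ ^ 2) (Icc ε ω) := by
    fun_prop
  refine ((hc.integrableOn_Icc).mono_set Ioo_subset_Icc_self).congr_fun ?_ measurableSet_Ioo
  intro x hx
  have hn : Ioc 0 ω ∈ nhds x := Ioc_mem_nhds (hε.trans hx.1) hx.2
  simp only [tauFst, tauSnd, derivWithin_of_mem_nhds hn]

lemma core_ineq (ω : ℝ) (hω : ω ∈ Ioo 0 (π / 2)) (k : ℤ)
    (ψ₁ ψ₂ ψ₃ ψ₄ : ℝ → ℂ) (hψ : InCore ω ψ₁ ψ₂ ψ₃ ψ₄) (μ : ℝ)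
    (u v u' v' : ℝ → ℝ)
    (hu : ∀ θ ∈ Ioc 0 ω, HasDerivAt u (u' θ) θ) (hv : ∀ θ ∈ Ioc 0 ω, HasDerivAt v (v' θ) θ)
    (hu' : ∀ θ ∈ Ioo 0 ω,
      u' θ + 2 * (((k : ℝ) + 1 / 2) / Real.sin θ) * u θ + u θ ^ 2 ≤ - μ ^ 2)
    (hv' : ∀ θ ∈ Ioo 0 ω,
      v' θ + 2 * (-(((k : ℝ) + 1 / 2) / Real.sin θ)) * v θ + v θ ^ 2 ≤ - μ ^ 2)
    (huv : u ω + v ω = 0) :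
    IntegrableOn (fun θ => ‖ψ₁ θ‖ ^ 2 + ‖ψ₂ θ‖ ^ 2 + ‖ψ₃ θ‖ ^ 2 + ‖ψ₄ θ‖ ^ 2) (Ioo 0 ω) ∧
    μ ^ 2 * ∫ θ in Ioo 0 ω, (‖ψ₁ θ‖ ^ 2 + ‖ψ₂ θ‖ ^ 2 + ‖ψ₃ θ‖ ^ 2 + ‖ψ₄ θ‖ ^ 2) ≤
      ∫ θ in Ioo 0 ω,
        (‖tauFst k ψ₁ ψ₂ θ‖ ^ 2 + ‖tauSnd k ψ₁ ψ₂ θ‖ ^ 2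
          + ‖tauFst k ψ₃ ψ₄ θ‖ ^ 2 + ‖tauSnd k ψ₃ ψ₄ θ‖ ^ 2) := by
  obtain ⟨d1, d2, d3, d4, -, s1, -, s2, -, s3, -, s4, b1, b2⟩ := hψ
  obtain ⟨hω0, hω2⟩ := hω
  obtain ⟨ε₀, hε₀, hv0⟩ := Metric.eventually_nhds_iff.1 ((vanish_near _ _ s1).and
    ((vanish_near _ _ s2).and ((vanish_near _ _ s3).and (vanish_near _ _ s4))))
  obtain ⟨ε, hε, hεω, hεz⟩ : ∃ ε : ℝ, 0 < ε ∧ ε < ω ∧ ∀ t, 0 < t → t ≤ ε →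
      t ∉ tsupport ψ₁ ∧ t ∉ tsupport ψ₂ ∧ t ∉ tsupport ψ₃ ∧ t ∉ tsupport ψ₄ := by
    refine ⟨min (ε₀ / 2) (ω / 2), by positivity, (min_le_right _ _).trans_lt (by linarith), ?_⟩
    intro t ht ht'
    apply hv0
    rw [Real.dist_eq, sub_zero, abs_of_pos ht]
    linarith [min_le_left (ε₀ / 2) (ω / 2)]
  have z : ∀ t, 0 < t → t ≤ ε → (ψ₁ t = 0 ∧ ψ₂ t = 0 ∧ ψ₃ t = 0 ∧ ψ₄ t = 0) ∧
      (deriv ψ₁ t = 0 ∧ deriv ψ₂ t = 0 ∧ deriv ψ₃ t = 0 ∧ deriv ψ₄ t = 0) := by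
    intro t h1 h2
    obtain ⟨h1, h2, h3, h4⟩ := hεz t h1 h2
    exact ⟨⟨image_eq_zero_of_notMem_tsupport h1, image_eq_zero_of_notMem_tsupport h2,
      image_eq_zero_of_notMem_tsupport h3, image_eq_zero_of_notMem_tsupport h4⟩,
      deriv_of_notMem_tsupport h1, deriv_of_notMem_tsupport h2,
      deriv_of_notMem_tsupport h3, deriv_of_notMem_tsupport h4⟩
  have hsub : Icc ε ω ⊆ Ioc 0 ω := fun x hx => ⟨hε.trans_le hx.1, hx.2⟩
  have hsubo : Ioo ε ω ⊆ Ioo 0 ω := Ioo_subset_Ioo_left hε.le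
  have c1 := d1.continuousOn.mono hsub
  have c2 := d2.continuousOn.mono hsub
  have c3 := d3.continuousOn.mono hsub
  have c4 := d4.continuousOn.mono hsub
  have iN : IntegrableOn (fun θ => ‖ψ₁ θ‖ ^ 2 + ‖ψ₂ θ‖ ^ 2 + ‖ψ₃ θ‖ ^ 2 + ‖ψ₄ θ‖ ^ 2)
      (Ioo ε ω) := by
    have : ContinuousOn (fun θ => ‖ψ₁ θ‖ ^ 2 + ‖ψ₂ θ‖ ^ 2 + ‖ψ₃ θ‖ ^ 2 + ‖ψ₄ θ‖ ^ 2)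
      (Icc ε ω) := by fun_prop
    exact this.integrableOn_Icc.mono_set Ioo_subset_Icc_self
  have iT : IntegrableOn (fun θ => ‖tauFst k ψ₁ ψ₂ θ‖ ^ 2 + ‖tauSnd k ψ₁ ψ₂ θ‖ ^ 2
          + ‖tauFst k ψ₃ ψ₄ θ‖ ^ 2 + ‖tauSnd k ψ₃ ψ₄ θ‖ ^ 2) (Ioo ε ω) := by
    refine ((tau_contExt k ω ε hω2 hε ψ₁ ψ₂ d1 d2).add
      (tau_contExt k ω ε hω2 hε ψ₃ ψ₄ d3 d4)).congr_fun (fun x _ => ?_) measurableSet_Ioo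
    simp only [Pi.add_apply]; ring
  have zN : ∀ t ∈ Ioo 0 ω \ Ioo ε ω,
      ‖ψ₁ t‖ ^ 2 + ‖ψ₂ t‖ ^ 2 + ‖ψ₃ t‖ ^ 2 + ‖ψ₄ t‖ ^ 2 = 0 := by
    rintro t ⟨ht, ht'⟩
    have : t ≤ ε := by
      by_contra h; exact ht' ⟨not_le.1 h, ht.2⟩
    obtain ⟨⟨h1, h2, h3, h4⟩, -⟩ := z t ht.1 this
    simp [h1, h2, h3, h4]
  have zT : ∀ t ∈ Ioo 0 ω \ Ioo ε ω, ‖tauFst k ψ₁ ψ₂ t‖ ^ 2 + ‖tauSnd k ψ₁ ψ₂ t‖ ^ 2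
          + ‖tauFst k ψ₃ ψ₄ t‖ ^ 2 + ‖tauSnd k ψ₃ ψ₄ t‖ ^ 2 = 0 := by
    rintro t ⟨ht, ht'⟩
    have : t ≤ ε := by
      by_contra h; exact ht' ⟨not_le.1 h, ht.2⟩
    obtain ⟨⟨h1, h2, h3, h4⟩, h5, h6, h7, h8⟩ := z t ht.1 this
    simp [tauFst, tauSnd, h1, h2, h3, h4, h5, h6, h7, h8]
  refine ⟨iN.of_forall_sdiff_eq_zero measurableSet_Ioo zN, ?_⟩
  rw [setIntegral_eq_of_subset_of_forall_sdiff_eq_zero measurableSet_Ioo hsubo zN,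
    setIntegral_eq_of_subset_of_forall_sdiff_eq_zero measurableSet_Ioo hsubo zT,
    ← integral_const_mul, ← sub_nonneg, ← integral_sub iT (iN.const_mul _)]
  set B : ℝ → ℝ := fun t => u t * ‖rotA ψ₁ ψ₂ t‖ ^ 2 + v t * ‖rotB ψ₁ ψ₂ t‖ ^ 2
    + (u t * ‖rotA ψ₃ ψ₄ t‖ ^ 2 + v t * ‖rotB ψ₃ ψ₄ t‖ ^ 2) with hB
  have key : ∀ θ ∈ Ioo ε ω, ∃ d, HasDerivAt B d θ ∧ d ≤
      (‖tauFst k ψ₁ ψ₂ θ‖ ^ 2 + ‖tauSnd k ψ₁ ψ₂ θ‖ ^ 2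
          + ‖tauFst k ψ₃ ψ₄ θ‖ ^ 2 + ‖tauSnd k ψ₃ ψ₄ θ‖ ^ 2) -
      μ ^ 2 * (‖ψ₁ θ‖ ^ 2 + ‖ψ₂ θ‖ ^ 2 + ‖ψ₃ θ‖ ^ 2 + ‖ψ₄ θ‖ ^ 2) := by
    intro θ hθ
    have hθ0 := hsubo hθ
    have hn : Ioc 0 ω ∈ nhds θ := Ioc_mem_nhds hθ0.1 hθ0.2
    have hs : Real.sin θ ≠ 0 :=
      (Real.sin_pos_of_pos_of_lt_pi hθ0.1 (by linarith [hθ0.2, Real.pi_pos])).ne'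
    have dd : ∀ f : ℝ → ℂ, ContDiffOn ℝ (⊤ : ℕ∞) f (Ioc 0 ω) → DifferentiableAt ℝ f θ :=
      fun f hf => (hf.contDiffAt hn).differentiableAt (by simp)
    obtain ⟨A, A', hA, hA', e⟩ := tau_rot k ψ₁ ψ₂ θ hs (dd _ d1) (dd _ d2)
    obtain ⟨C, C', hC, hC', e'⟩ := tau_rot k ψ₃ ψ₄ θ hs (dd _ d3) (dd _ d4)
    have hθc := Ioo_subset_Ioc_self hθ0
    obtain ⟨x1, hx1, hy1⟩ := pt_ineq _ _ _ _ _ μ _ hA (hu θ hθc) (hu' θ hθ0)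
    obtain ⟨x2, hx2, hy2⟩ := pt_ineq _ _ _ _ _ μ _ hA' (hv θ hθc) (hv' θ hθ0)
    obtain ⟨x3, hx3, hy3⟩ := pt_ineq _ _ _ _ _ μ _ hC (hu θ hθc) (hu' θ hθ0)
    obtain ⟨x4, hx4, hy4⟩ := pt_ineq _ _ _ _ _ μ _ hC' (hv θ hθc) (hv' θ hθ0)
    refine ⟨_, (hx1.add hx2).add (hx3.add hx4), ?_⟩
    have r1 := rot_pair ψ₁ ψ₂ θ
    have r2 := rot_pair ψ₃ ψ₄ θ
    have : μ ^ 2 * (‖ψ₁ θ‖ ^ 2 + ‖ψ₂ θ‖ ^ 2 + ‖ψ₃ θ‖ ^ 2 + ‖ψ₄ θ‖ ^ 2) =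
      μ ^ 2 * ‖rotA ψ₁ ψ₂ θ‖ ^ 2 + μ ^ 2 * ‖rotB ψ₁ ψ₂ θ‖ ^ 2 +
      μ ^ 2 * ‖rotA ψ₃ ψ₄ θ‖ ^ 2 + μ ^ 2 * ‖rotB ψ₃ ψ₄ θ‖ ^ 2 := by
      linear_combination - μ ^ 2 * r1 - μ ^ 2 * r2
    linarith
  choose! d hd hd' using key
  have cu : ContinuousOn u (Icc ε ω) :=
    fun x hx => (hu x (hsub hx)).continuousAt.continuousWithinAt
  have cv : ContinuousOn v (Icc ε ω) :=
    fun x hx => (hv x (hsub hx)).continuousAt.continuousWithinAt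
  have cB : ContinuousOn B (Icc ε ω) := by
    simp only [hB, rotA, rotB]
    fun_prop
  have iφ : IntegrableOn (fun θ => (‖tauFst k ψ₁ ψ₂ θ‖ ^ 2 + ‖tauSnd k ψ₁ ψ₂ θ‖ ^ 2
          + ‖tauFst k ψ₃ ψ₄ θ‖ ^ 2 + ‖tauSnd k ψ₃ ψ₄ θ‖ ^ 2) -
      μ ^ 2 * (‖ψ₁ θ‖ ^ 2 + ‖ψ₂ θ‖ ^ 2 + ‖ψ₃ θ‖ ^ 2 + ‖ψ₄ θ‖ ^ 2)) (Icc ε ω) :=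
    (integrableOn_Icc_iff_integrableOn_Ioo (by finiteness) (by finiteness)).2 (iT.sub (iN.const_mul _))
  have fin := intervalIntegral.sub_le_integral_of_hasDeriv_right_of_le hεω.le cB
    (fun x hx => (hd x hx).hasDerivWithinAt) iφ hd'
  rw [intervalIntegral.integral_of_le hεω.le, integral_Ioc_eq_integral_Ioo] at fin
  have B0 : B ε = 0 := by
    obtain ⟨⟨h1, h2, h3, h4⟩, -⟩ := z ε hε le_rfl
    simp [hB, rotA, rotB, h1, h2, h3, h4]
  have B1 : B ω = 0 := by
    have e1 : Real.sin ω = 2 * Real.sin (ω / 2) * Real.cos (ω / 2) := by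
      rw [← Real.sin_two_mul]; congr 1; ring
    have e2 : Real.cos ω = 2 * Real.cos (ω / 2) ^ 2 - 1 := by
      rw [← Real.cos_two_mul]; congr 1; ring
    have e3 : ((Real.sin (ω / 2) : ℝ) : ℂ) ^ 2 = 1 - ((Real.cos (ω / 2) : ℝ) : ℂ) ^ 2 := by
      rw [eq_sub_iff_add_eq]; exact_mod_cast Real.sin_sq_add_cos_sq (ω / 2)
    have f1 : rotA ψ₁ ψ₂ ω = -Complex.I * rotB ψ₃ ψ₄ ω := by
      unfold rotA rotB
      rw [b1, b2, e1, e2]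
      push_cast at e3 ⊢
      linear_combination (-2 * Complex.I * Complex.cos (ω / 2) * ψ₄ ω) * e3
    have f2 : rotB ψ₁ ψ₂ ω = -Complex.I * rotA ψ₃ ψ₄ ω := by
      unfold rotA rotB
      rw [b1, b2, e1, e2]
      push_cast at e3 ⊢
      linear_combination (-2 * Complex.I * Complex.cos (ω / 2) * ψ₃ ω) * e3
    simp only [hB, f1, f2, norm_mul, norm_neg, Complex.norm_I, one_mul]
    linear_combination (‖rotA ψ₃ ψ₄ ω‖ ^ 2 + ‖rotB ψ₃ ψ₄ ω‖ ^ 2) * huv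
  linarith

lemma wcond (S C ν μ a : ℝ) (hS : 0 < S) (hC : 0 < C) (h1 : S ^ 2 + C ^ 2 = 1)
    (hμ : 0 < μ) (hν : μ = ν + 1 / 2) (h : 1 / 2 ≤ 2 * a * (S * C)) :
    (-μ * ν / C ^ 2 + 2 * a * (-μ * (S / C)) + (-μ * (S / C)) ^ 2 ≤ - μ ^ 2) ∧
    (-μ * ν / S ^ 2 + 2 * (-a) * (μ * (C / S)) + (μ * (C / S)) ^ 2 ≤ - μ ^ 2) := by
  have e : 0 ≤ μ * (2 * a * (S * C) - 1 / 2) := mul_nonneg hμ.le (by linarith)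
  constructor
  · have : -μ * ν / C ^ 2 + 2 * a * (-μ * (S / C)) + (-μ * (S / C)) ^ 2 + μ ^ 2
        = -(μ * (2 * a * (S * C) - 1 / 2)) / C ^ 2 := by
      field_simp
      linear_combination 2 * μ * h1 + 2 * hν
    have h2 : -(μ * (2 * a * (S * C) - 1 / 2)) / C ^ 2 ≤ 0 :=
      div_nonpos_of_nonpos_of_nonneg (by linarith) (by positivity)
    linarith
  · have : -μ * ν / S ^ 2 + 2 * (-a) * (μ * (C / S)) + (μ * (C / S)) ^ 2 + μ ^ 2
        = -(μ * (2 * a * (S * C) - 1 / 2)) / S ^ 2 := by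
      field_simp
      linear_combination 2 * μ * h1 + 2 * hν
    have h2 : -(μ * (2 * a * (S * C) - 1 / 2)) / S ^ 2 ≤ 0 :=
      div_nonpos_of_nonpos_of_nonneg (by linarith) (by positivity)
    linarith

lemma gap_sq (ω : ℝ) (hω : ω ∈ Ioo 0 (π / 2)) (k : ℤ)
    (ψ₁ ψ₂ ψ₃ ψ₄ : ℝ → ℂ) (hψ : InCore ω ψ₁ ψ₂ ψ₃ ψ₄) :
    IntegrableOn (fun θ => ‖ψ₁ θ‖ ^ 2 + ‖ψ₂ θ‖ ^ 2 + ‖ψ₃ θ‖ ^ 2 + ‖ψ₄ θ‖ ^ 2) (Ioo 0 ω) ∧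
    (π / (4 * ω) + 1 / 2) ^ 2 *
      ∫ θ in Ioo 0 ω, (‖ψ₁ θ‖ ^ 2 + ‖ψ₂ θ‖ ^ 2 + ‖ψ₃ θ‖ ^ 2 + ‖ψ₄ θ‖ ^ 2) ≤
      ∫ θ in Ioo 0 ω,
        (‖tauFst k ψ₁ ψ₂ θ‖ ^ 2 + ‖tauSnd k ψ₁ ψ₂ θ‖ ^ 2
          + ‖tauFst k ψ₃ ψ₄ θ‖ ^ 2 + ‖tauSnd k ψ₃ ψ₄ θ‖ ^ 2) := by
  have hω0 : 0 < ω := hω.1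
  have hω2 : ω < π / 2 := hω.2
  have hπ := Real.pi_pos
  obtain ⟨ν, hν⟩ : ∃ ν, ν = π / (4 * ω) := ⟨_, rfl⟩
  obtain ⟨μ, hμ⟩ : ∃ μ, μ = ν + 1 / 2 := ⟨_, rfl⟩
  have hνω : ν * ω = π / 4 := by rw [hν]; field_simp
  have hν0 : 0 < ν := by rw [hν]; positivity
  have hν1 : 1 / 2 ≤ ν := by
    by_contra hc
    push Not at hc
    nlinarith
  have hμ0 : 0 < μ := by linarith
  rw [← hν, ← hμ]
  have rng : ∀ θ ∈ Ioc 0 ω, 0 < ν * θ ∧ ν * θ ≤ π / 4 := fun θ hθ =>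
    ⟨mul_pos hν0 hθ.1, hνω ▸ mul_le_mul_of_nonneg_left hθ.2 hν0.le⟩
  have hS : ∀ θ ∈ Ioc 0 ω, 0 < Real.sin (ν * θ) := fun θ hθ =>
    Real.sin_pos_of_pos_of_lt_pi (rng θ hθ).1 (by linarith [(rng θ hθ).2])
  have hC : ∀ θ ∈ Ioc 0 ω, 0 < Real.cos (ν * θ) := fun θ hθ =>
    Real.cos_pos_of_mem_Ioo ⟨by linarith [(rng θ hθ).1], by linarith [(rng θ hθ).2]⟩
  have dS : ∀ θ, HasDerivAt (fun t => Real.sin (ν * t)) (ν * Real.cos (ν * θ)) θ := fun θ => by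
    have := (((hasDerivAt_id θ).const_mul ν).sin)
    simp only [id, mul_one] at this
    rw [mul_comm]; exact this
  have dC : ∀ θ, HasDerivAt (fun t => Real.cos (ν * t)) (-ν * Real.sin (ν * θ)) θ := fun θ => by
    have := (((hasDerivAt_id θ).const_mul ν).cos)
    simp only [id, mul_one] at this
    convert this using 1; ring
  have du : ∀ θ ∈ Ioc 0 ω, HasDerivAt (fun t => -μ * (Real.sin (ν * t) / Real.cos (ν * t)))
      (-μ * ν / Real.cos (ν * θ) ^ 2) θ := fun θ hθ => by
    have hc := (hC θ hθ).ne'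
    refine (((dS θ).div (dC θ) hc).const_mul (-μ)).congr_deriv ?_
    field_simp
    linear_combination (-1 : ℝ) * Real.sin_sq_add_cos_sq (ν * θ)
  have dv : ∀ θ ∈ Ioc 0 ω, HasDerivAt (fun t => μ * (Real.cos (ν * t) / Real.sin (ν * t)))
      (-μ * ν / Real.sin (ν * θ) ^ 2) θ := fun θ hθ => by
    have hc := (hS θ hθ).ne'
    refine (((dC θ).div (dS θ) hc).const_mul μ).congr_deriv ?_
    field_simp
    linear_combination (-1 : ℝ) * Real.sin_sq_add_cos_sq (ν * θ)
  have hbd : -μ * (Real.sin (ν * ω) / Real.cos (ν * ω)) +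
      μ * (Real.cos (ν * ω) / Real.sin (ν * ω)) = 0 := by
    rw [hνω, Real.sin_pi_div_four, Real.cos_pi_div_four]; ring
  have hsin : ∀ θ ∈ Ioo 0 ω, 0 < Real.sin θ ∧
      Real.sin θ ≤ 2 * (Real.sin (ν * θ) * Real.cos (ν * θ)) := fun θ hθ => by
    have r := rng θ (Ioo_subset_Ioc_self hθ)
    refine ⟨Real.sin_pos_of_pos_of_lt_pi hθ.1 (by linarith [hθ.2]), ?_⟩
    rw [← mul_assoc, ← Real.sin_two_mul]
    apply Real.sin_le_sin_of_le_of_le_pi_div_two <;> nlinarith [hθ.1, hθ.2]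
  have hcond : ∀ κ : ℝ, 1 / 2 ≤ κ → ∀ θ ∈ Ioo 0 ω,
      1 / 2 ≤ 2 * (κ / Real.sin θ) * (Real.sin (ν * θ) * Real.cos (ν * θ)) := by
    intro κ hκ θ hθ
    obtain ⟨h1, h2⟩ := hsin θ hθ
    rw [show 2 * (κ / Real.sin θ) * (Real.sin (ν * θ) * Real.cos (ν * θ)) =
      κ * (2 * (Real.sin (ν * θ) * Real.cos (ν * θ))) / Real.sin θ by ring, le_div_iff₀ h1]
    nlinarith
  rcases le_or_gt 0 k with hk | hk
  · have hκ : 1 / 2 ≤ (k : ℝ) + 1 / 2 := by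
      have : (0 : ℝ) ≤ k := by exact_mod_cast hk
      linarith
    have W := fun θ (hθ : θ ∈ Ioo 0 ω) => wcond _ _ ν μ _ (hS θ (Ioo_subset_Ioc_self hθ))
      (hC θ (Ioo_subset_Ioc_self hθ)) (Real.sin_sq_add_cos_sq _) hμ0 hμ (hcond _ hκ θ hθ)
    exact core_ineq ω hω k ψ₁ ψ₂ ψ₃ ψ₄ hψ μ _ _ _ _ du dv (fun θ hθ => (W θ hθ).1)
      (fun θ hθ => (W θ hθ).2) hbd
  · have hκ : 1 / 2 ≤ -((k : ℝ) + 1 / 2) := by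
      have : (k : ℝ) ≤ -1 := by exact_mod_cast (by lia : k ≤ -1)
      linarith
    have W := fun θ (hθ : θ ∈ Ioo 0 ω) => wcond _ _ ν μ _ (hS θ (Ioo_subset_Ioc_self hθ))
      (hC θ (Ioo_subset_Ioc_self hθ)) (Real.sin_sq_add_cos_sq _) hμ0 hμ (hcond _ hκ θ hθ)
    simp only [neg_div, neg_neg] at W
    simp only [← neg_div] at W
    refine core_ineq ω hω k ψ₁ ψ₂ ψ₃ ψ₄ hψ μ _ _ _ _ dv du (fun θ hθ => ?_)
      (fun θ hθ => ?_) (by rw [add_comm]; exact hbd)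
    · have := (W θ hθ).2
      convert this using 3
    · have := (W θ hθ).1
      convert this using 3
      simp only [neg_div]

/-- Spectral gap of the fiber operator on convex cones (Proposition 4.6, on the core):
for `ω ∈ (0, π/2)`, `k ∈ ℤ` and every `ψ ∈ M`,
`‖T_k ψ‖ ≥ (π/(4ω) + 1/2) ‖ψ‖`; in particular `T_k ψ = 0` implies `ψ = 0`. -/
theorem fiber_spectral_gap (ω : ℝ) (hω : ω ∈ Ioo 0 (π / 2)) (k : ℤ)
    (ψ₁ ψ₂ ψ₃ ψ₄ : ℝ → ℂ) (hψ : InCore ω ψ₁ ψ₂ ψ₃ ψ₄) :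
    (Real.sqrt (∫ θ in Ioo 0 ω,
        (‖tauFst k ψ₁ ψ₂ θ‖ ^ 2 + ‖tauSnd k ψ₁ ψ₂ θ‖ ^ 2
          + ‖tauFst k ψ₃ ψ₄ θ‖ ^ 2 + ‖tauSnd k ψ₃ ψ₄ θ‖ ^ 2)) ≥
      (π / (4 * ω) + 1 / 2) * Real.sqrt (∫ θ in Ioo 0 ω,
        (‖ψ₁ θ‖ ^ 2 + ‖ψ₂ θ‖ ^ 2 + ‖ψ₃ θ‖ ^ 2 + ‖ψ₄ θ‖ ^ 2)))
    ∧ ((∀ θ ∈ Ioo 0 ω, tauFst k ψ₁ ψ₂ θ = 0 ∧ tauSnd k ψ₁ ψ₂ θ = 0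
          ∧ tauFst k ψ₃ ψ₄ θ = 0 ∧ tauSnd k ψ₃ ψ₄ θ = 0) →
        ∀ θ ∈ Ioc 0 ω, ψ₁ θ = 0 ∧ ψ₂ θ = 0 ∧ ψ₃ θ = 0 ∧ ψ₄ θ = 0) := by
  obtain ⟨hI, h⟩ := gap_sq ω hω k ψ₁ ψ₂ ψ₃ ψ₄ hψ
  obtain ⟨hω0, hω2⟩ := hω
  have hμ : 0 < π / (4 * ω) + 1 / 2 := by positivity
  refine ⟨?_, fun hT => ?_⟩
  · apply Real.le_sqrt_of_sq_le
    rw [mul_pow, Real.sq_sqrt (integral_nonneg (fun θ => by positivity))]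
    exact h
  · have hz : ∫ θ in Ioo 0 ω,
        (‖tauFst k ψ₁ ψ₂ θ‖ ^ 2 + ‖tauSnd k ψ₁ ψ₂ θ‖ ^ 2
          + ‖tauFst k ψ₃ ψ₄ θ‖ ^ 2 + ‖tauSnd k ψ₃ ψ₄ θ‖ ^ 2) = 0 := by
      apply setIntegral_eq_zero_of_forall_eq_zero
      intro x hx
      obtain ⟨h1, h2, h3, h4⟩ := hT x hx
      simp [h1, h2, h3, h4]
    rw [hz] at h
    have h0 : ∫ θ in Ioo 0 ω, (‖ψ₁ θ‖ ^ 2 + ‖ψ₂ θ‖ ^ 2 + ‖ψ₃ θ‖ ^ 2 + ‖ψ₄ θ‖ ^ 2) = 0 :=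
      le_antisymm (nonpos_of_mul_nonpos_right h (by positivity))
        (integral_nonneg (fun θ => by positivity))
    rw [setIntegral_eq_zero_iff_of_nonneg_ae
      (Filter.Eventually.of_forall (fun θ => by simp only [Pi.zero_apply]; positivity)) hI,
      restrict_Ioo_eq_restrict_Ioc] at h0
    obtain ⟨d1, d2, d3, d4, -⟩ := hψ
    have c1 := d1.continuousOn
    have c2 := d2.continuousOn
    have c3 := d3.continuousOn
    have c4 := d4.continuousOn
    have he := Measure.eqOn_Ioc_of_ae_eq _ h0 (by fun_prop) (by fun_prop)
    intro θ hθ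
    have e := he hθ
    simp only [Pi.zero_apply] at e
    have n1 := sq_nonneg ‖ψ₁ θ‖
    have n2 := sq_nonneg ‖ψ₂ θ‖
    have n3 := sq_nonneg ‖ψ₃ θ‖
    have n4 := sq_nonneg ‖ψ₄ θ‖
    refine ⟨?_, ?_, ?_, ?_⟩ <;> rw [← norm_eq_zero, ← sq_eq_zero_iff] <;> linarith

end
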